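/- For every n ∈ ℕ⁺, every union-closed family 𝒮 ⊆ 2^{[n]} in which every element of [n] belongs to at most 2^{n−1} − 1 sets of 𝒮 satisfies |𝒮| ≤ 2ⁿ − n. -/

import Mathlib

/-- A family of subsets of `[n]` (modeled as `Fin n`) is union-closed if it is
closed under pairwise unions. -/
def UnionClosed {n : ℕ} (𝒮 : Finset (Finset (Fin n))) : Prop :=
  ∀ A ∈ 𝒮, ∀ B ∈ 𝒮, A ∪ B ∈ 𝒮

/-- A nonempty set missing from a union-closed family has an element `x` such that all its subsets
containing `x` are missing as well. -/
theorem UnionClosed.exists_forall_notMem {n : ℕ} {𝒮 : Finset (Finset (Fin n))}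
    (hUC : UnionClosed 𝒮) {C : Finset (Fin n)} (hC : C.Nonempty) (hCS : C ∉ 𝒮) :
    ∃ x ∈ C, ∀ D ⊆ C, x ∈ D → D ∉ 𝒮 := by
  by_contra! h
  have h' : ∀ x, ∃ D, x ∈ C → D ⊆ C ∧ x ∈ D ∧ D ∈ 𝒮 := fun x => by
    by_cases hx : x ∈ C
    · obtain ⟨D, hD⟩ := h x hx
      exact ⟨D, fun _ => hD⟩
    · exact ⟨∅, fun hx' => absurd hx' hx⟩
  choose f hf using h'
  have hmem : C.sup' hC f ∈ (𝒮 : Set (Finset (Fin n))) :=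
    Finset.sup'_mem _ (fun A hA B hB => hUC A hA B hB) C hC f fun x hx => (hf x hx).2.2
  have heq : C.sup' hC f = C := by
    apply le_antisymm
    · exact Finset.sup'_le hC f fun x hx => (hf x hx).1
    · intro x hx
      exact Finset.le_sup' f hx (hf x hx).2.1
  rw [heq] at hmem
  exact hCS hmem

/-- If every element lies in a set missing from a union-closed family on `[n]`, then at least `n`
sets are missing. -/
theorem UnionClosed.le_card_compl {n : ℕ} {𝒮 : Finset (Finset (Fin n))} (hUC : UnionClosed 𝒮)
    (hcover : ∀ e, ∃ C, e ∈ C ∧ C ∉ 𝒮) : n ≤ (𝒮ᶜ).card := by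
  have h : ∀ y, ∃ x, ({x} : Finset (Fin n)) ∉ 𝒮 ∧ ({x, y} : Finset (Fin n)) ∉ 𝒮 := fun y => by
    obtain ⟨C, hyC, hCS⟩ := hcover y
    obtain ⟨x, hxC, hx⟩ := hUC.exists_forall_notMem ⟨y, hyC⟩ hCS
    exact ⟨x, hx _ (by simpa using hxC) (by simp),
      hx _ (by simp [Finset.insert_subset_iff, hxC, hyC]) (by simp)⟩
  choose g hg using h
  let f : Fin n → Finset (Fin n) := fun y => if {y} ∈ 𝒮 then {g y, y} else {y}
  have hf : ∀ y, f y ∈ 𝒮ᶜ := fun y => by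
    by_cases hy : {y} ∈ 𝒮
    · simpa [f, hy] using (hg y).2
    · simp [f, hy]
  have hinj : Function.Injective f := by
    intro y z hyz
    have hgy := (hg y).1
    have hgz := (hg z).1
    have hm : ∀ a, a ∈ f y ↔ a ∈ f z := fun a => by rw [hyz]
    have hmy := hm y
    have hmz := hm z
    have hmgy := hm (g y)
    have hmgz := hm (g z)
    by_cases hy : {y} ∈ 𝒮 <;> by_cases hz : {z} ∈ 𝒮 <;> simp [f, hy, hz] at hmy hmz hmgy hmgz <;>
      grind
  simpa using Finset.card_le_card_of_injOn (s := Finset.univ) f (fun y _ => hf y) hinj.injOn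

/-- A union-closed family on `[n]` in which every element is in at most
`2^(n-1) - 1` sets has at most `2^n - n` sets. -/
theorem unionClosed_card_le_of_freq_le
    (n : ℕ) (hn : 0 < n)
    (𝒮 : Finset (Finset (Fin n))) (hUC : UnionClosed 𝒮)
    (hfreq : ∀ e : Fin n, (𝒮.filter (fun A => e ∈ A)).card ≤ 2 ^ (n - 1) - 1) :
    𝒮.card ≤ 2 ^ n - n := by
  have hcover : ∀ e, ∃ C, e ∈ C ∧ C ∉ 𝒮 := by
    intro e
    by_contra! h
    have hle : (Finset.powerset ({e}ᶜ : Finset (Fin n))).card ≤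
        (𝒮.filter (fun A => e ∈ A)).card := by
      refine Finset.card_le_card_of_injOn (insert e) (fun A _ => ?_) fun A hA B hB hAB => ?_
      · simpa using h _ (Finset.mem_insert_self e A)
      · have hA' : e ∉ A := by simpa using hA
        have hB' : e ∉ B := by simpa using hB
        rw [← Finset.erase_insert hA', ← Finset.erase_insert hB', hAB]
    rw [Finset.card_powerset, Finset.card_compl, Finset.card_singleton, Fintype.card_fin] at hle
    have := hfreq e
    have : 0 < 2 ^ (n - 1) := by positivity
    omega
  have h₁ := hUC.le_card_compl hcover
  have h₂ := Finset.card_add_card_compl 𝒮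
  rw [Fintype.card_finset, Fintype.card_fin] at h₂
  omega
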